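/- arXiv:2011.10383 — 6 statements merged into one kernel-verified Lean document; each statement's English description precedes it below -/
import Mathlib

section
/- In G4iSL□, the rule L→→ is height-preserving invertible with respect to its right premise: if Γ, (φ→ψ)→γ ⇒ Δ has a G4iSL□-derivation of height at most d, then Γ, γ ⇒ Δ has a G4iSL□-derivation of height at most d. -/
/-- Formulas of propositional intuitionistic modal logic. -/
inductive Form : Type
  | atom : ℕ → Form
  | bot : Form
  | and : Form → Form → Form
  | or : Form → Form → Form
  | imp : Form → Form → Form
  | box : Form → Form
  deriving DecidableEq

/-- □Γ : box every formula in the multiset. -/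
def boxM (Γ : Multiset Form) : Multiset Form := Γ.map Form.box

/-- ⊡Γ = Γ ∪ □Γ (multiset union = sum). -/
def boxdot (Γ : Multiset Form) : Multiset Form := Γ + boxM Γ

/-- The multiset contains no boxed formulas. -/
def NoBox (P : Multiset Form) : Prop := ∀ φ ∈ P, ∀ ψ : Form, φ ≠ Form.box ψ

/-- The sequent calculus G4iSL□ with a height bound:
`G4iSL d Γ Δ` means that the sequent Γ ⇒ Δ has a G4iSL□-derivation
of height at most `d`. -/
inductive G4iSL : ℕ → Multiset Form → Option Form → Prop
  | axAt {d : ℕ} {Γ : Multiset Form} {p : ℕ} :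
      G4iSL (d + 1) (Form.atom p ::ₘ Γ) (some (Form.atom p))
  | axBot {d : ℕ} {Γ : Multiset Form} {Δ : Option Form} :
      G4iSL (d + 1) (Form.bot ::ₘ Γ) Δ
  | rAnd {d : ℕ} {Γ : Multiset Form} {φ ψ : Form} :
      G4iSL d Γ (some φ) → G4iSL d Γ (some ψ) →
      G4iSL (d + 1) Γ (some (Form.and φ ψ))
  | lAnd {d : ℕ} {Γ : Multiset Form} {φ ψ : Form} {Δ : Option Form} :
      G4iSL d (φ ::ₘ ψ ::ₘ Γ) Δ →
      G4iSL (d + 1) (Form.and φ ψ ::ₘ Γ) Δ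
  | rOrL {d : ℕ} {Γ : Multiset Form} {φ ψ : Form} :
      G4iSL d Γ (some φ) → G4iSL (d + 1) Γ (some (Form.or φ ψ))
  | rOrR {d : ℕ} {Γ : Multiset Form} {φ ψ : Form} :
      G4iSL d Γ (some ψ) → G4iSL (d + 1) Γ (some (Form.or φ ψ))
  | lOr {d : ℕ} {Γ : Multiset Form} {φ ψ : Form} {Δ : Option Form} :
      G4iSL d (φ ::ₘ Γ) Δ → G4iSL d (ψ ::ₘ Γ) Δ →
      G4iSL (d + 1) (Form.or φ ψ ::ₘ Γ) Δ
  | rImp {d : ℕ} {Γ : Multiset Form} {φ ψ : Form} :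
      G4iSL d (φ ::ₘ Γ) (some ψ) →
      G4iSL (d + 1) Γ (some (Form.imp φ ψ))
  | lAtImp {d : ℕ} {Γ : Multiset Form} {p : ℕ} {φ : Form} {Δ : Option Form} :
      G4iSL d (Form.atom p ::ₘ φ ::ₘ Γ) Δ →
      G4iSL (d + 1) (Form.atom p ::ₘ Form.imp (Form.atom p) φ ::ₘ Γ) Δ
  | lAndImp {d : ℕ} {Γ : Multiset Form} {φ ψ χ : Form} {Δ : Option Form} :
      G4iSL d (Form.imp φ (Form.imp ψ χ) ::ₘ Γ) Δ →
      G4iSL (d + 1) (Form.imp (Form.and φ ψ) χ ::ₘ Γ) Δ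
  | lOrImp {d : ℕ} {Γ : Multiset Form} {φ ψ χ : Form} {Δ : Option Form} :
      G4iSL d (Form.imp φ χ ::ₘ Form.imp ψ χ ::ₘ Γ) Δ →
      G4iSL (d + 1) (Form.imp (Form.or φ ψ) χ ::ₘ Γ) Δ
  | lImpImp {d : ℕ} {Γ : Multiset Form} {φ ψ χ : Form} {Δ : Option Form} :
      G4iSL d (Form.imp ψ χ ::ₘ Γ) (some (Form.imp φ ψ)) →
      G4iSL d (χ ::ₘ Γ) Δ →
      G4iSL (d + 1) (Form.imp (Form.imp φ ψ) χ ::ₘ Γ) Δ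
  | impSL {d : ℕ} {S Γ : Multiset Form} {φ ψ : Form} {Δ : Option Form} :
      G4iSL d (Form.box φ ::ₘ (S + boxdot Γ)) (some φ) →
      G4iSL d (ψ ::ₘ (S + boxM Γ)) Δ →
      G4iSL (d + 1) (Form.imp (Form.box φ) ψ ::ₘ (S + boxM Γ)) Δ
  | rSL4 {d : ℕ} {S Γ : Multiset Form} {φ : Form} :
      G4iSL d (Form.box φ ::ₘ (S + boxdot Γ)) (some φ) →
      G4iSL (d + 1) (S + boxM Γ) (some (Form.box φ))

/-- Derivability in G4iSL□ (some derivation of some height). -/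
def G4Der (Γ : Multiset Form) (Δ : Option Form) : Prop := ∃ d, G4iSL d Γ Δ

theorem G4iSL.succ {d : ℕ} {Γ : Multiset Form} {Δ : Option Form} (h : G4iSL d Γ Δ) :
    G4iSL (d + 1) Γ Δ := by
  induction h with
  | axAt => exact .axAt
  | axBot => exact .axBot
  | rAnd _ _ ih₁ ih₂ => exact .rAnd ih₁ ih₂
  | lAnd _ ih => exact .lAnd ih
  | rOrL _ ih => exact .rOrL ih
  | rOrR _ ih => exact .rOrR ih
  | lOr _ _ ih₁ ih₂ => exact .lOr ih₁ ih₂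
  | rImp _ ih => exact .rImp ih
  | lAtImp _ ih => exact .lAtImp ih
  | lAndImp _ ih => exact .lAndImp ih
  | lOrImp _ ih => exact .lOrImp ih
  | lImpImp _ _ ih₁ ih₂ => exact .lImpImp ih₁ ih₂
  | impSL _ _ ih₁ ih₂ => exact .impSL ih₁ ih₂
  | rSL4 _ ih => exact .rSL4 ih

theorem G4iSL.of_eq {d : ℕ} {Γ Γ' : Multiset Form} {Δ : Option Form} (h : G4iSL d Γ Δ)
    (e : Γ = Γ') : G4iSL d Γ' Δ := e ▸ h

theorem Multiset.exists_of_cons_eq_cons_of_ne {α : Type*} {a b : α} {s t : Multiset α}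
    (h : a ::ₘ s = b ::ₘ t) (hab : a ≠ b) : ∃ u, s = b ::ₘ u ∧ t = a ::ₘ u := by
  rcases Multiset.cons_eq_cons.1 h with ⟨e, _⟩ | ⟨_, hu⟩
  · exact absurd e hab
  · exact hu

/-- An implication in a context `S + □Γ` lies in `S`. -/
theorem exists_of_add_boxM_eq_imp_cons {S Γ T : Multiset Form} {α β : Form}
    (h : S + boxM Γ = Form.imp α β ::ₘ T) :
    ∃ S', S = Form.imp α β ::ₘ S' ∧ T = S' + boxM Γ := by
  have hmem : Form.imp α β ∈ S + boxM Γ := h ▸ Multiset.mem_cons_self _ _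
  have hS : Form.imp α β ∈ S := by
    rcases Multiset.mem_add.1 hmem with hS | hΓ
    · exact hS
    · simp [boxM] at hΓ
  obtain ⟨S', rfl⟩ := Multiset.exists_cons_of_mem hS
  refine ⟨S', rfl, ?_⟩
  rw [Multiset.cons_add] at h
  exact ((Multiset.cons_inj_right _).1 h).symm

theorem G4iSL.lImpImp_inversion_of_eq {d : ℕ} {Γ Γ' : Multiset Form} {φ ψ γ : Form}
    {Δ : Option Form} (h : G4iSL d Γ' Δ) (e : Γ' = Form.imp (Form.imp φ ψ) γ ::ₘ Γ) :
    G4iSL d (γ ::ₘ Γ) Δ := by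
  induction h generalizing Γ with
  | axAt =>
    obtain ⟨T, rfl, rfl⟩ := Multiset.exists_of_cons_eq_cons_of_ne e (by simp)
    rw [Multiset.cons_swap]
    exact .axAt
  | axBot =>
    obtain ⟨T, rfl, rfl⟩ := Multiset.exists_of_cons_eq_cons_of_ne e (by simp)
    rw [Multiset.cons_swap]
    exact .axBot
  | rAnd _ _ ih₁ ih₂ => exact .rAnd (ih₁ e) (ih₂ e)
  | @lAnd _ _ α β _ _ ih =>
    obtain ⟨T, rfl, rfl⟩ := Multiset.exists_of_cons_eq_cons_of_ne e (by simp)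
    rw [Multiset.cons_swap]
    refine .lAnd ((ih (Γ := α ::ₘ β ::ₘ T) ?_).of_eq ?_) <;>
      simp only [← Multiset.singleton_add] <;> abel
  | rOrL _ ih => exact .rOrL (ih e)
  | rOrR _ ih => exact .rOrR (ih e)
  | @lOr _ _ α β _ _ _ ih₁ ih₂ =>
    obtain ⟨T, rfl, rfl⟩ := Multiset.exists_of_cons_eq_cons_of_ne e (by simp)
    rw [Multiset.cons_swap]
    refine .lOr ((ih₁ (Γ := α ::ₘ T) ?_).of_eq ?_) ((ih₂ (Γ := β ::ₘ T) ?_).of_eq ?_) <;>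
      exact Multiset.cons_swap _ _ _
  | @rImp _ _ α _ _ ih =>
    subst e
    exact .rImp ((ih (Γ := α ::ₘ Γ) (Multiset.cons_swap _ _ _)).of_eq (Multiset.cons_swap _ _ _))
  | @lAtImp _ _ p α _ _ ih =>
    obtain ⟨T, e', rfl⟩ := Multiset.exists_of_cons_eq_cons_of_ne e (by simp)
    obtain ⟨T, rfl, rfl⟩ := Multiset.exists_of_cons_eq_cons_of_ne e' (by simp)
    refine (G4iSL.lAtImp (Γ := γ ::ₘ T) (p := p) (φ := α)
      ((ih (Γ := Form.atom p ::ₘ α ::ₘ T) ?_).of_eq ?_)).of_eq ?_ <;>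
      simp only [← Multiset.singleton_add] <;> abel
  | @lAndImp _ _ α β χ _ _ ih =>
    obtain ⟨T, rfl, rfl⟩ := Multiset.exists_of_cons_eq_cons_of_ne e (by simp)
    rw [Multiset.cons_swap]
    exact .lAndImp ((ih (Γ := Form.imp α (Form.imp β χ) ::ₘ T) (Multiset.cons_swap _ _ _)).of_eq
      (Multiset.cons_swap _ _ _))
  | @lOrImp _ _ α β χ _ _ ih =>
    obtain ⟨T, rfl, rfl⟩ := Multiset.exists_of_cons_eq_cons_of_ne e (by simp)
    rw [Multiset.cons_swap]
    refine .lOrImp ((ih (Γ := Form.imp α χ ::ₘ Form.imp β χ ::ₘ T) ?_).of_eq ?_) <;>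
      simp only [← Multiset.singleton_add] <;> abel
  | @lImpImp _ _ α β χ _ _ h₂ ih₁ ih₂ =>
    rcases Multiset.cons_eq_cons.1 e with ⟨e₁, rfl⟩ | ⟨_, T, rfl, rfl⟩
    · obtain ⟨_, rfl⟩ := Form.imp.inj e₁
      exact h₂.succ
    · rw [Multiset.cons_swap]
      refine .lImpImp ((ih₁ (Γ := Form.imp β χ ::ₘ T) ?_).of_eq ?_)
        ((ih₂ (Γ := χ ::ₘ T) ?_).of_eq ?_) <;> exact Multiset.cons_swap _ _ _
  | @impSL _ _ Γ₀ α β _ _ _ ih₁ ih₂ =>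
    obtain ⟨T, e', rfl⟩ := Multiset.exists_of_cons_eq_cons_of_ne e (by simp)
    obtain ⟨S, rfl, rfl⟩ := exists_of_add_boxM_eq_imp_cons e'
    refine (G4iSL.impSL (S := γ ::ₘ S) (Γ := Γ₀) (φ := α) (ψ := β)
      ((ih₁ (Γ := Form.box α ::ₘ (S + boxdot Γ₀)) ?_).of_eq ?_)
      ((ih₂ (Γ := β ::ₘ (S + boxM Γ₀)) ?_).of_eq ?_)).of_eq ?_ <;>
      simp only [← Multiset.singleton_add] <;> abel
  | @rSL4 _ _ Γ₀ α _ ih =>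
    obtain ⟨S, rfl, rfl⟩ := exists_of_add_boxM_eq_imp_cons e
    refine (G4iSL.rSL4 (S := γ ::ₘ S) (Γ := Γ₀)
      ((ih (Γ := Form.box α ::ₘ (S + boxdot Γ₀)) ?_).of_eq ?_)).of_eq ?_ <;>
      simp only [← Multiset.singleton_add] <;> abel

/-- the rule L→→ of G4iSL□ is height-preserving invertible with
respect to its right premise. -/
theorem g4isl_lImpImp_inversion {d : ℕ} {Γ : Multiset Form} {φ ψ γ : Form}
    {Δ : Option Form}
    (h : G4iSL d (Form.imp (Form.imp φ ψ) γ ::ₘ Γ) Δ) :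
    G4iSL d (γ ::ₘ Γ) Δ :=
  h.lImpImp_inversion_of_eq rfl
end

section
/- Strong weakening for cutfree proofs in G3iSL□: if the sequent Γ ⇒ Δ has a cutfree G3iSL□-derivation of height d, then for every finite multiset Θ of formulas both Γ, Θ ⇒ Δ and Γ, □Θ ⇒ Δ have cutfree G3iSL□-derivations of height d. -/
/-- The sequent calculus G3iSL□ with a height bound:
`G3iSL d Γ Δ` means that the sequent Γ ⇒ Δ has a (cutfree) G3iSL□-derivation
of height at most `d`. -/
inductive G3iSL : ℕ → Multiset Form → Option Form → Prop
  | axAt {d : ℕ} {Γ : Multiset Form} {p : ℕ} :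
      G3iSL (d + 1) (Form.atom p ::ₘ Γ) (some (Form.atom p))
  | axBot {d : ℕ} {Γ : Multiset Form} {Δ : Option Form} :
      G3iSL (d + 1) (Form.bot ::ₘ Γ) Δ
  | rAnd {d : ℕ} {Γ : Multiset Form} {φ ψ : Form} :
      G3iSL d Γ (some φ) → G3iSL d Γ (some ψ) →
      G3iSL (d + 1) Γ (some (Form.and φ ψ))
  | lAnd {d : ℕ} {Γ : Multiset Form} {φ ψ : Form} {Δ : Option Form} :
      G3iSL d (φ ::ₘ ψ ::ₘ Γ) Δ →
      G3iSL (d + 1) (Form.and φ ψ ::ₘ Γ) Δ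
  | rOrL {d : ℕ} {Γ : Multiset Form} {φ ψ : Form} :
      G3iSL d Γ (some φ) → G3iSL (d + 1) Γ (some (Form.or φ ψ))
  | rOrR {d : ℕ} {Γ : Multiset Form} {φ ψ : Form} :
      G3iSL d Γ (some ψ) → G3iSL (d + 1) Γ (some (Form.or φ ψ))
  | lOr {d : ℕ} {Γ : Multiset Form} {φ ψ : Form} {Δ : Option Form} :
      G3iSL d (φ ::ₘ Γ) Δ → G3iSL d (ψ ::ₘ Γ) Δ →
      G3iSL (d + 1) (Form.or φ ψ ::ₘ Γ) Δ
  | rImp {d : ℕ} {Γ : Multiset Form} {φ ψ : Form} :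
      G3iSL d (φ ::ₘ Γ) (some ψ) →
      G3iSL (d + 1) Γ (some (Form.imp φ ψ))
  | lImp {d : ℕ} {Γ : Multiset Form} {φ ψ : Form} {Δ : Option Form} :
      G3iSL d (Form.imp φ ψ ::ₘ Γ) (some φ) → G3iSL d (ψ ::ₘ Γ) Δ →
      G3iSL (d + 1) (Form.imp φ ψ ::ₘ Γ) Δ
  | rSL {d : ℕ} {S P Γ : Multiset Form} {φ : Form} :
      NoBox P →
      G3iSL d (Form.box φ ::ₘ (P + boxdot Γ)) (some φ) →
      G3iSL (d + 1) (boxM S + P + boxM Γ) (some (Form.box φ))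

/-- Derivability in G3iSL□ (some derivation of some height). -/
def G3Der (Γ : Multiset Form) (Δ : Option Form) : Prop := ∃ d, G3iSL d Γ Δ

/-- Height-preserving weakening by a single formula. -/
theorem G3iSL.weaken_cons {d : ℕ} {Γ : Multiset Form} {Δ : Option Form}
    (h : G3iSL d Γ Δ) (χ : Form) : G3iSL d (χ ::ₘ Γ) Δ := by
  induction h with
  | axAt => rw [Multiset.cons_swap]; exact .axAt
  | axBot => rw [Multiset.cons_swap]; exact .axBot
  | rAnd _ _ ih₁ ih₂ => exact .rAnd ih₁ ih₂
  | lAnd _ ih =>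
    rw [Multiset.cons_swap]
    refine .lAnd ?_
    rwa [Multiset.cons_swap _ χ, Multiset.cons_swap _ χ]
  | rOrL _ ih => exact .rOrL ih
  | rOrR _ ih => exact .rOrR ih
  | lOr _ _ ih₁ ih₂ =>
    rw [Multiset.cons_swap] at ih₁ ih₂ ⊢
    exact .lOr ih₁ ih₂
  | rImp _ ih =>
    rw [Multiset.cons_swap] at ih
    exact .rImp ih
  | lImp _ _ ih₁ ih₂ =>
    rw [Multiset.cons_swap] at ih₁ ih₂ ⊢
    exact .lImp ih₁ ih₂
  | @rSL d S P Γ φ hP h ih =>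
    by_cases hχ : ∃ ψ, χ = Form.box ψ
    · obtain ⟨ψ, rfl⟩ := hχ
      have key := G3iSL.rSL (S := ψ ::ₘ S) hP h
      simpa [boxM] using key
    · have hP' : NoBox (χ ::ₘ P) := fun α hα ψ hψ => by
        rcases Multiset.mem_cons.1 hα with rfl | hα
        · exact hχ ⟨ψ, hψ⟩
        · exact hP α hα ψ hψ
      rw [Multiset.cons_swap, ← Multiset.cons_add] at ih
      simpa using G3iSL.rSL (S := S) hP' ih

/-- Height-preserving weakening by a multiset of formulas. -/
theorem G3iSL.weaken_add {d : ℕ} {Γ : Multiset Form} {Δ : Option Form}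
    (h : G3iSL d Γ Δ) (Θ : Multiset Form) : G3iSL d (Γ + Θ) Δ := by
  induction Θ using Multiset.induction with
  | empty => simpa using h
  | cons χ Θ ih =>
    rw [Multiset.add_cons]
    exact ih.weaken_cons χ

/-- strong weakening for cutfree proofs in G3iSL□. -/
theorem g3isl_strong_weakening {d : ℕ} {Γ : Multiset Form} {Δ : Option Form}
    (h : G3iSL d Γ Δ) (Θ : Multiset Form) :
    G3iSL d (Γ + Θ) Δ ∧ G3iSL d (Γ + boxM Θ) Δ :=
  ⟨h.weaken_add Θ, h.weaken_add (boxM Θ)⟩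
end

section
/- Cut-elimination for G3iSL□: the cut rule — from Γ₁ ⇒ φ and φ, Γ₂ ⇒ Δ infer Γ₁, Γ₂ ⇒ Δ — is admissible in G3iSL□; that is, every sequent derivable in G3iSL□ extended with cut is derivable in G3iSL□ without cut. -/
/-- G3iSL□ extended with the cut rule. -/
inductive G3iSLC : Multiset Form → Option Form → Prop
  | axAt {Γ : Multiset Form} {p : ℕ} :
      G3iSLC (Form.atom p ::ₘ Γ) (some (Form.atom p))
  | axBot {Γ : Multiset Form} {Δ : Option Form} :
      G3iSLC (Form.bot ::ₘ Γ) Δ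
  | rAnd {Γ : Multiset Form} {φ ψ : Form} :
      G3iSLC Γ (some φ) → G3iSLC Γ (some ψ) → G3iSLC Γ (some (Form.and φ ψ))
  | lAnd {Γ : Multiset Form} {φ ψ : Form} {Δ : Option Form} :
      G3iSLC (φ ::ₘ ψ ::ₘ Γ) Δ → G3iSLC (Form.and φ ψ ::ₘ Γ) Δ
  | rOrL {Γ : Multiset Form} {φ ψ : Form} :
      G3iSLC Γ (some φ) → G3iSLC Γ (some (Form.or φ ψ))
  | rOrR {Γ : Multiset Form} {φ ψ : Form} :
      G3iSLC Γ (some ψ) → G3iSLC Γ (some (Form.or φ ψ))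
  | lOr {Γ : Multiset Form} {φ ψ : Form} {Δ : Option Form} :
      G3iSLC (φ ::ₘ Γ) Δ → G3iSLC (ψ ::ₘ Γ) Δ → G3iSLC (Form.or φ ψ ::ₘ Γ) Δ
  | rImp {Γ : Multiset Form} {φ ψ : Form} :
      G3iSLC (φ ::ₘ Γ) (some ψ) → G3iSLC Γ (some (Form.imp φ ψ))
  | lImp {Γ : Multiset Form} {φ ψ : Form} {Δ : Option Form} :
      G3iSLC (Form.imp φ ψ ::ₘ Γ) (some φ) → G3iSLC (ψ ::ₘ Γ) Δ →
      G3iSLC (Form.imp φ ψ ::ₘ Γ) Δ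
  | rSL {S P Γ : Multiset Form} {φ : Form} :
      NoBox P →
      G3iSLC (Form.box φ ::ₘ (P + boxdot Γ)) (some φ) →
      G3iSLC (boxM S + P + boxM Γ) (some (Form.box φ))
  | cut {Γ₁ Γ₂ : Multiset Form} {φ : Form} {Δ : Option Form} :
      G3iSLC Γ₁ (some φ) → G3iSLC (φ ::ₘ Γ₂) Δ →
      G3iSLC (Γ₁ + Γ₂) Δ

/-! ### Derivability without heights -/

namespace G3iSL

theorem mono {d e : ℕ} {Γ : Multiset Form} {Δ : Option Form} (h : G3iSL d Γ Δ) (hde : d ≤ e) :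
    G3iSL e Γ Δ := by
  induction h generalizing e <;>
    obtain ⟨e, rfl⟩ := Nat.exists_eq_add_of_le' (Nat.le_of_add_left_le hde)
  case axAt => exact .axAt
  case axBot => exact .axBot
  case rAnd ih₁ ih₂ => exact .rAnd (ih₁ (by omega)) (ih₂ (by omega))
  case lAnd ih => exact .lAnd (ih (by omega))
  case rOrL ih => exact .rOrL (ih (by omega))
  case rOrR ih => exact .rOrR (ih (by omega))
  case lOr ih₁ ih₂ => exact .lOr (ih₁ (by omega)) (ih₂ (by omega))
  case rImp ih => exact .rImp (ih (by omega))
  case lImp ih₁ ih₂ => exact .lImp (ih₁ (by omega)) (ih₂ (by omega))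
  case rSL hP _ ih => exact .rSL hP (ih (by omega))

theorem toG3iSLC {d : ℕ} {Γ : Multiset Form} {Δ : Option Form} (h : G3iSL d Γ Δ) :
    G3iSLC Γ Δ := by
  induction h with
  | axAt => exact .axAt
  | axBot => exact .axBot
  | rAnd _ _ ih₁ ih₂ => exact .rAnd ih₁ ih₂
  | lAnd _ ih => exact .lAnd ih
  | rOrL _ ih => exact .rOrL ih
  | rOrR _ ih => exact .rOrR ih
  | lOr _ _ ih₁ ih₂ => exact .lOr ih₁ ih₂
  | rImp _ ih => exact .rImp ih
  | lImp _ _ ih₁ ih₂ => exact .lImp ih₁ ih₂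
  | rSL hP _ ih => exact .rSL hP ih

end G3iSL

namespace G3Der

variable {Γ : Multiset Form} {Δ : Option Form} {φ ψ : Form}

theorem common_height {Γ' : Multiset Form} {Δ' : Option Form}
    (h : G3Der Γ Δ) (h' : G3Der Γ' Δ') : ∃ d, G3iSL d Γ Δ ∧ G3iSL d Γ' Δ' := by
  obtain ⟨d, h⟩ := h
  obtain ⟨d', h'⟩ := h'
  exact ⟨max d d', h.mono (le_max_left _ _), h'.mono (le_max_right _ _)⟩

theorem atom_of_mem {p : ℕ} (h : Form.atom p ∈ Γ) : G3Der Γ (some (.atom p)) := by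
  obtain ⟨Γ, rfl⟩ := Multiset.exists_cons_of_mem h
  exact ⟨1, .axAt⟩

theorem of_bot_mem (h : Form.bot ∈ Γ) : G3Der Γ Δ := by
  obtain ⟨Γ, rfl⟩ := Multiset.exists_cons_of_mem h
  exact ⟨1, .axBot⟩

theorem rAnd (h₁ : G3Der Γ (some φ)) (h₂ : G3Der Γ (some ψ)) : G3Der Γ (some (.and φ ψ)) := by
  obtain ⟨d, h₁, h₂⟩ := common_height h₁ h₂
  exact ⟨d + 1, .rAnd h₁ h₂⟩

theorem lAnd (h : G3Der (φ ::ₘ ψ ::ₘ Γ) Δ) : G3Der (Form.and φ ψ ::ₘ Γ) Δ := by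
  obtain ⟨d, h⟩ := h
  exact ⟨d + 1, .lAnd h⟩

theorem rOrL (h : G3Der Γ (some φ)) : G3Der Γ (some (.or φ ψ)) := by
  obtain ⟨d, h⟩ := h
  exact ⟨d + 1, .rOrL h⟩

theorem rOrR (h : G3Der Γ (some ψ)) : G3Der Γ (some (.or φ ψ)) := by
  obtain ⟨d, h⟩ := h
  exact ⟨d + 1, .rOrR h⟩

theorem lOr (h₁ : G3Der (φ ::ₘ Γ) Δ) (h₂ : G3Der (ψ ::ₘ Γ) Δ) :
    G3Der (Form.or φ ψ ::ₘ Γ) Δ := by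
  obtain ⟨d, h₁, h₂⟩ := common_height h₁ h₂
  exact ⟨d + 1, .lOr h₁ h₂⟩

theorem rImp (h : G3Der (φ ::ₘ Γ) (some ψ)) : G3Der Γ (some (.imp φ ψ)) := by
  obtain ⟨d, h⟩ := h
  exact ⟨d + 1, .rImp h⟩

theorem lImp (h₁ : G3Der (Form.imp φ ψ ::ₘ Γ) (some φ)) (h₂ : G3Der (ψ ::ₘ Γ) Δ) :
    G3Der (Form.imp φ ψ ::ₘ Γ) Δ := by
  obtain ⟨d, h₁, h₂⟩ := common_height h₁ h₂
  exact ⟨d + 1, .lImp h₁ h₂⟩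

theorem rSL {P : Multiset Form} (hP : NoBox P)
    (h : G3Der (Form.box φ ::ₘ (P + boxdot Γ)) (some φ)) : G3Der (P + boxM Γ) (some (.box φ)) := by
  obtain ⟨d, h⟩ := h
  refine ⟨d + 1, ?_⟩
  simpa [boxM] using G3iSL.rSL (S := 0) hP h

end G3Der

theorem exists_noBox_add_boxM (Γ : Multiset Form) : ∃ P G, NoBox P ∧ Γ = P + boxM G := by
  induction Γ using Multiset.induction_on with
  | empty => exact ⟨0, 0, by simp [NoBox], by simp [boxM]⟩
  | cons φ Γ ih =>
    obtain ⟨P, G, hP, rfl⟩ := ih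
    by_cases hφ : ∃ ψ, φ = .box ψ
    · obtain ⟨ψ, rfl⟩ := hφ
      exact ⟨P, ψ ::ₘ G, hP, by simp [boxM]⟩
    · refine ⟨φ ::ₘ P, G, ?_, by simp⟩
      intro χ hχ ψ h
      rcases Multiset.mem_cons.1 hχ with rfl | hχ
      · exact hφ ⟨ψ, h⟩
      · exact hP χ hχ ψ h

/-! ### Structural rules -/

/-- `Covered Γ φ` means that `φ` reduces to members of `Γ` by inverting left rules. -/
inductive Covered (Γ : Multiset Form) : Form → Prop
  | mem {φ : Form} : φ ∈ Γ → Covered Γ φ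
  | and {φ ψ : Form} : Covered Γ φ → Covered Γ ψ → Covered Γ (.and φ ψ)
  | orL {φ ψ : Form} : Covered Γ φ → Covered Γ (.or φ ψ)
  | orR {φ ψ : Form} : Covered Γ ψ → Covered Γ (.or φ ψ)
  | imp {φ ψ : Form} : Covered Γ ψ → Covered Γ (.imp φ ψ)

namespace Covered

theorem trans {Γ Γ' : Multiset Form} {φ : Form} (h : Covered Γ φ)
    (hΓ : ∀ ψ ∈ Γ, Covered Γ' ψ) : Covered Γ' φ := by
  induction h with
  | mem h => exact hΓ _ h
  | and _ _ ih₁ ih₂ => exact .and ih₁ ih₂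
  | orL _ ih => exact .orL ih
  | orR _ ih => exact .orR ih
  | imp _ ih => exact .imp ih

theorem cons {Γ Γ' : Multiset Form} (χ : Form) (h : ∀ ψ ∈ Γ, Covered Γ' ψ) :
    ∀ ψ ∈ χ ::ₘ Γ, Covered (χ ::ₘ Γ') ψ := by
  intro ψ hψ
  rcases Multiset.mem_cons.1 hψ with rfl | hψ
  · exact .mem (by simp)
  · exact (h ψ hψ).trans fun _ h => .mem (Multiset.mem_cons_of_mem h)

end Covered

/-- Weakening, contraction and inversion of the left rules, in one statement. -/
theorem G3Der.of_covered {Γ Γ' : Multiset Form} {Δ : Option Form} (h : G3Der Γ Δ)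
    (hΓ : ∀ φ ∈ Γ, Covered Γ' φ) : G3Der Γ' Δ := by
  obtain ⟨d, h⟩ := h
  induction h generalizing Γ' with
  | @axAt _ _ p =>
    cases hΓ (.atom p) (by simp) with
    | mem h => exact .atom_of_mem h
  | axBot =>
    cases hΓ .bot (by simp) with
    | mem h => exact .of_bot_mem h
  | rAnd _ _ ih₁ ih₂ => exact .rAnd (ih₁ hΓ) (ih₂ hΓ)
  | rOrL _ ih => exact .rOrL (ih hΓ)
  | rOrR _ ih => exact .rOrR (ih hΓ)
  | rImp _ ih => exact .rImp (ih (Covered.cons _ hΓ))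
  | @lAnd _ Γ φ ψ _ _ ih =>
    have hΓ₀ : ∀ χ ∈ Γ, Covered Γ' χ := fun χ h => hΓ χ (Multiset.mem_cons_of_mem h)
    cases hΓ (.and φ ψ) (by simp) with
    | mem h =>
      obtain ⟨Γ', rfl⟩ := Multiset.exists_cons_of_mem h
      refine .lAnd (ih ?_)
      have key : ∀ χ ∈ Form.and φ ψ ::ₘ Γ', Covered (φ ::ₘ ψ ::ₘ Γ') χ := by
        intro χ hχ
        rcases Multiset.mem_cons.1 hχ with rfl | hχ
        · exact .and (.mem (by simp)) (.mem (by simp))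
        · exact .mem (by simp [hχ])
      intro χ hχ
      simp only [Multiset.mem_cons] at hχ
      rcases hχ with rfl | rfl | hχ
      · exact .mem (by simp)
      · exact .mem (by simp)
      · exact (hΓ₀ χ hχ).trans key
    | and h₁ h₂ =>
      refine ih fun χ hχ => ?_
      simp only [Multiset.mem_cons] at hχ
      rcases hχ with rfl | rfl | hχ
      · exact h₁
      · exact h₂
      · exact hΓ₀ χ hχ
  | @lOr _ Γ φ ψ _ _ _ ih₁ ih₂ =>
    have hΓ₀ : ∀ χ ∈ Γ, Covered Γ' χ := fun χ h => hΓ χ (Multiset.mem_cons_of_mem h)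
    cases hΓ (.or φ ψ) (by simp) with
    | mem h =>
      obtain ⟨Γ', rfl⟩ := Multiset.exists_cons_of_mem h
      refine .lOr (ih₁ ?_) (ih₂ ?_)
      · refine fun χ hχ => (Covered.cons φ hΓ₀ χ hχ).trans fun θ hθ => ?_
        simp only [Multiset.mem_cons] at hθ
        rcases hθ with rfl | rfl | hθ
        · exact .mem (by simp)
        · exact .orL (.mem (by simp))
        · exact .mem (by simp [hθ])
      · refine fun χ hχ => (Covered.cons ψ hΓ₀ χ hχ).trans fun θ hθ => ?_
        simp only [Multiset.mem_cons] at hθ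
        rcases hθ with rfl | rfl | hθ
        · exact .mem (by simp)
        · exact .orR (.mem (by simp))
        · exact .mem (by simp [hθ])
    | orL h =>
      exact ih₁ (Multiset.forall_mem_cons.2 ⟨h, hΓ₀⟩)
    | orR h =>
      exact ih₂ (Multiset.forall_mem_cons.2 ⟨h, hΓ₀⟩)
  | @lImp _ Γ φ ψ _ _ _ ih₁ ih₂ =>
    have hΓ₀ : ∀ χ ∈ Γ, Covered Γ' χ := fun χ h => hΓ χ (Multiset.mem_cons_of_mem h)
    cases hΓ (.imp φ ψ) (by simp) with
    | mem h =>
      obtain ⟨Γ', rfl⟩ := Multiset.exists_cons_of_mem h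
      refine .lImp (ih₁ hΓ) (ih₂ ?_)
      refine fun χ hχ => (Covered.cons ψ hΓ₀ χ hχ).trans fun θ hθ => ?_
      simp only [Multiset.mem_cons] at hθ
      rcases hθ with rfl | rfl | hθ
      · exact .mem (by simp)
      · exact .imp (.mem (by simp))
      · exact .mem (by simp [hθ])
    | imp h => exact ih₂ (Multiset.forall_mem_cons.2 ⟨h, hΓ₀⟩)
  | @rSL _ S P Γ φ hP _ ih =>
    obtain ⟨P', G, hP', rfl⟩ := exists_noBox_add_boxM Γ'
    refine .rSL hP' (ih (Covered.cons _ fun χ hχ => ?_))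
    have sub : ∀ θ, Covered (P' + boxM G) θ → Covered (P' + boxdot G) θ := fun θ h =>
      h.trans fun η hη => .mem (by
        simp only [boxdot, Multiset.mem_add] at hη ⊢
        tauto)
    simp only [boxdot, Multiset.mem_add] at hχ
    rcases hχ with hχ | hχ | hχ
    · exact sub _ (hΓ χ (by simp [hχ]))
    · cases hΓ (.box χ) (by simp [boxM, hχ]) with
      | mem h =>
        rcases Multiset.mem_add.1 h with h | h
        · exact absurd rfl (hP' _ h χ)
        · refine .mem ?_
          simp only [boxM, Multiset.mem_map, Form.box.injEq, exists_eq_right] at h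
          simp [boxdot, h]
    · exact sub _ (hΓ χ (by simp [hχ]))

theorem G3Der.of_subset {Γ Γ' : Multiset Form} {Δ : Option Form} (h : G3Der Γ Δ)
    (hΓ : Γ ⊆ Γ') : G3Der Γ' Δ :=
  h.of_covered fun _ h => .mem (hΓ h)

theorem G3Der.of_box_mem {Γ : Multiset Form} {φ : Form} (h : Form.box φ ∈ Γ)
    (ih : ∀ Γ : Multiset Form, φ ∈ Γ → G3Der Γ (some φ)) : G3Der Γ (some (.box φ)) := by
  obtain ⟨P, G, hP, rfl⟩ := exists_noBox_add_boxM Γ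
  refine .rSL hP (ih _ ?_)
  rcases Multiset.mem_add.1 h with h | h
  · exact absurd rfl (hP _ h φ)
  · simp only [boxM, Multiset.mem_map, Form.box.injEq, exists_eq_right] at h
    simp [boxdot, h]

theorem G3Der.of_mem {Γ : Multiset Form} {φ : Form} (h : φ ∈ Γ) : G3Der Γ (some φ) := by
  induction φ generalizing Γ with
  | atom p => exact .atom_of_mem h
  | bot => exact .of_bot_mem h
  | and φ ψ ih₁ ih₂ =>
    obtain ⟨Γ, rfl⟩ := Multiset.exists_cons_of_mem h
    exact .lAnd (.rAnd (ih₁ (by simp)) (ih₂ (by simp)))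
  | or φ ψ ih₁ ih₂ =>
    obtain ⟨Γ, rfl⟩ := Multiset.exists_cons_of_mem h
    exact .lOr (.rOrL (ih₁ (by simp))) (.rOrR (ih₂ (by simp)))
  | imp φ ψ ih₁ ih₂ =>
    obtain ⟨Γ, rfl⟩ := Multiset.exists_cons_of_mem h
    refine .rImp ?_
    rw [Multiset.cons_swap]
    exact .lImp (ih₁ (by simp)) (ih₂ (by simp))
  | box φ ih => exact .of_box_mem h fun _ => ih

/-! ### Kripke semantics -/

/-- A Kripke model of intuitionistic strong Löb logic. -/
structure SLModel (W : Type) where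
  /-- the intuitionistic order -/
  le : W → W → Prop
  /-- the modal relation -/
  rel : W → W → Prop
  /-- the valuation -/
  val : ℕ → W → Prop
  le_refl : ∀ w, le w w
  le_trans : ∀ {u v w}, le u v → le v w → le u w
  le_of_rel : ∀ {v w}, rel v w → le v w
  rel_of_le_of_rel : ∀ {u v w}, le u v → rel v w → rel u w
  wf : WellFounded (flip rel)
  val_mono : ∀ {p v w}, le v w → val p v → val p w

namespace SLModel

variable {W : Type} (M : SLModel W)

/-- The forcing relation. -/
def Forces : Form → W → Prop
  | .atom p, w => M.val p w
  | .bot, _ => False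
  | .and φ ψ, w => Forces φ w ∧ Forces ψ w
  | .or φ ψ, w => Forces φ w ∨ Forces ψ w
  | .imp φ ψ, w => ∀ v, M.le w v → Forces φ v → Forces ψ v
  | .box φ, w => ∀ v, M.rel w v → Forces φ v

/-- Forcing of a succedent; the empty one is never forced. -/
def ForcesSucc (Δ : Option Form) (w : W) : Prop := ∃ φ ∈ Δ, M.Forces φ w

variable {M}

@[simp] theorem forcesSucc_some {φ : Form} {w : W} :
    M.ForcesSucc (some φ) w ↔ M.Forces φ w := by
  simp [ForcesSucc]

theorem Forces.mono {φ : Form} {v w : W} (h : M.Forces φ v) (hvw : M.le v w) :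
    M.Forces φ w := by
  induction φ with
  | atom p => exact M.val_mono hvw h
  | bot => exact h
  | and φ ψ ih₁ ih₂ => exact ⟨ih₁ h.1, ih₂ h.2⟩
  | or φ ψ ih₁ ih₂ => exact h.imp ih₁ ih₂
  | imp φ ψ => exact fun u hu => h u (M.le_trans hvw hu)
  | box φ => exact fun u hu => h u (M.rel_of_le_of_rel hvw hu)

end SLModel

theorem G3iSLC.sound {Γ : Multiset Form} {Δ : Option Form} (h : G3iSLC Γ Δ) {W : Type}
    (M : SLModel W) (w : W) (hw : ∀ φ ∈ Γ, M.Forces φ w) : M.ForcesSucc Δ w := by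
  induction h generalizing w with
  | axAt => exact SLModel.forcesSucc_some.2 (hw _ (by simp))
  | axBot => exact (hw .bot (by simp)).elim
  | rAnd _ _ ih₁ ih₂ =>
    simp only [SLModel.forcesSucc_some] at ih₁ ih₂ ⊢
    exact ⟨ih₁ w hw, ih₂ w hw⟩
  | lAnd _ ih =>
    rw [Multiset.forall_mem_cons] at hw
    exact ih w (by simpa only [Multiset.forall_mem_cons] using ⟨hw.1.1, hw.1.2, hw.2⟩)
  | rOrL _ ih =>
    simp only [SLModel.forcesSucc_some] at ih ⊢
    exact .inl (ih w hw)
  | rOrR _ ih =>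
    simp only [SLModel.forcesSucc_some] at ih ⊢
    exact .inr (ih w hw)
  | lOr _ _ ih₁ ih₂ =>
    rw [Multiset.forall_mem_cons] at hw
    rcases hw.1 with h | h
    · exact ih₁ w (Multiset.forall_mem_cons.2 ⟨h, hw.2⟩)
    · exact ih₂ w (Multiset.forall_mem_cons.2 ⟨h, hw.2⟩)
  | rImp _ ih =>
    simp only [SLModel.forcesSucc_some] at ih ⊢
    exact fun v hv h => ih v (Multiset.forall_mem_cons.2 ⟨h, fun χ hχ => (hw χ hχ).mono hv⟩)
  | lImp _ _ ih₁ ih₂ =>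
    have h := SLModel.forcesSucc_some.1 (ih₁ w hw)
    rw [Multiset.forall_mem_cons] at hw
    exact ih₂ w (Multiset.forall_mem_cons.2 ⟨hw.1 w (M.le_refl w) h, hw.2⟩)
  | @rSL S P Γ φ _ _ ih =>
    simp only [SLModel.forcesSucc_some] at ih ⊢
    intro v
    induction v using M.wf.induction with
    | _ v ihv =>
      intro hv
      have hwv := M.le_of_rel hv
      refine ih v (Multiset.forall_mem_cons.2
        ⟨fun u hu => ihv u hu (M.rel_of_le_of_rel hwv hu), fun χ hχ => ?_⟩)
      simp only [boxdot, Multiset.mem_add] at hχ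
      rcases hχ with hχ | hχ | hχ
      · exact (hw χ (by simp [hχ])).mono hwv
      · exact hw (.box χ) (by simp [boxM, hχ]) v hv
      · exact (hw χ (by simp [hχ])).mono hwv
  | cut _ _ ih₁ ih₂ =>
    refine ih₂ w (Multiset.forall_mem_cons.2
      ⟨SLModel.forcesSucc_some.1 (ih₁ w fun χ hχ => hw χ ?_), fun χ hχ => hw χ ?_⟩) <;>
    simp [hχ]

/-! ### The canonical model -/

/-- Closure of a finite set of formulas under immediate subformulas. -/
structure SubClosed (C : Finset Form) : Prop where
  and : ∀ {φ ψ}, Form.and φ ψ ∈ C → φ ∈ C ∧ ψ ∈ C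
  or : ∀ {φ ψ}, Form.or φ ψ ∈ C → φ ∈ C ∧ ψ ∈ C
  imp : ∀ {φ ψ}, Form.imp φ ψ ∈ C → φ ∈ C ∧ ψ ∈ C
  box : ∀ {φ}, Form.box φ ∈ C → φ ∈ C

namespace SubClosed

theorem union {C D : Finset Form} (hC : SubClosed C) (hD : SubClosed D) :
    SubClosed (C ∪ D) := by
  obtain ⟨c₁, c₂, c₃, c₄⟩ := hC
  obtain ⟨d₁, d₂, d₃, d₄⟩ := hD
  constructor <;> intros <;> simp only [Finset.mem_union] at * <;> grind

theorem exists_mem (φ : Form) : ∃ C, SubClosed C ∧ φ ∈ C := by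
  induction φ with
  | atom p => exact ⟨{.atom p}, by constructor <;> simp, by simp⟩
  | bot => exact ⟨{.bot}, by constructor <;> simp, by simp⟩
  | and φ ψ ih₁ ih₂ =>
    obtain ⟨C, hC, hφ⟩ := ih₁
    obtain ⟨D, hD, hψ⟩ := ih₂
    obtain ⟨h₁, h₂, h₃, h₄⟩ := hC.union hD
    exact ⟨insert (.and φ ψ) (C ∪ D), by constructor <;> grind, by simp⟩
  | or φ ψ ih₁ ih₂ =>
    obtain ⟨C, hC, hφ⟩ := ih₁
    obtain ⟨D, hD, hψ⟩ := ih₂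
    obtain ⟨h₁, h₂, h₃, h₄⟩ := hC.union hD
    exact ⟨insert (.or φ ψ) (C ∪ D), by constructor <;> grind, by simp⟩
  | imp φ ψ ih₁ ih₂ =>
    obtain ⟨C, hC, hφ⟩ := ih₁
    obtain ⟨D, hD, hψ⟩ := ih₂
    obtain ⟨h₁, h₂, h₃, h₄⟩ := hC.union hD
    exact ⟨insert (.imp φ ψ) (C ∪ D), by constructor <;> grind, by simp⟩
  | box φ ih =>
    obtain ⟨C, ⟨h₁, h₂, h₃, h₄⟩, hφ⟩ := ih
    exact ⟨insert (.box φ) C, by constructor <;> grind, by simp⟩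

theorem exists_subset (Γ : Multiset Form) : ∃ C, SubClosed C ∧ ∀ φ ∈ Γ, φ ∈ C := by
  induction Γ using Multiset.induction_on with
  | empty => exact ⟨∅, by constructor <;> simp, by simp⟩
  | cons φ Γ ih =>
    obtain ⟨C, hC, hΓ⟩ := ih
    obtain ⟨D, hD, hφ⟩ := exists_mem φ
    refine ⟨D ∪ C, hD.union hC, Multiset.forall_mem_cons.2 ⟨by simp [hφ], fun χ hχ => ?_⟩⟩
    simp [hΓ χ hχ]

end SubClosed

/-- `T` is maximal among the subsets of `C` that do not derive `Δ`. -/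
def Saturated (C : Finset Form) (Δ : Option Form) (T : Finset Form) : Prop :=
  Maximal (fun S : Finset Form => S ⊆ C ∧ ¬ G3Der S.val Δ) T

namespace Saturated

variable {C T : Finset Form} {Δ : Option Form} {φ ψ : Form}

theorem exists_of_not_der (hT : T ⊆ C) (h : ¬ G3Der T.val Δ) :
    ∃ S, T ⊆ S ∧ Saturated C Δ S := by
  have hfin : {S : Finset Form | S ⊆ C ∧ ¬ G3Der S.val Δ}.Finite :=
    C.powerset.finite_toSet.subset fun S hS => by simpa using hS.1
  exact hfin.exists_le_maximal ⟨hT, h⟩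

theorem mem_of_not_der (hT : Saturated C Δ T) (hφ : φ ∈ C)
    (h : ¬ G3Der (φ ::ₘ T.val) Δ) : φ ∈ T := by
  refine hT.2 (y := insert φ T) ⟨Finset.insert_subset hφ hT.1.1, fun h' => h ?_⟩
    (Finset.subset_insert φ T) (Finset.mem_insert_self φ T)
  exact h'.of_subset fun χ hχ => by simpa using hχ

theorem not_der_cons (hT : Saturated C Δ T) (hφ : φ ∈ T) : ¬ G3Der (φ ::ₘ T.val) Δ :=
  fun h => hT.1.2 (h.of_subset fun χ hχ => by
    rcases Multiset.mem_cons.1 hχ with rfl | hχ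
    · exact hφ
    · exact hχ)

theorem mem_and (hC : SubClosed C) (hT : Saturated C Δ T) (h : Form.and φ ψ ∈ T) :
    φ ∈ T ∧ ψ ∈ T := by
  have hφψ := hC.and (hT.1.1 h)
  have key : ¬ G3Der (φ ::ₘ ψ ::ₘ T.val) Δ := fun h' => hT.not_der_cons h h'.lAnd
  refine ⟨hT.mem_of_not_der hφψ.1 fun h' => key (h'.of_subset ?_),
    hT.mem_of_not_der hφψ.2 fun h' => key (h'.of_subset ?_)⟩ <;>
  · intro χ hχ
    simp only [Multiset.mem_cons] at hχ ⊢
    tauto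

theorem mem_or (hC : SubClosed C) (hT : Saturated C Δ T) (h : Form.or φ ψ ∈ T) :
    φ ∈ T ∨ ψ ∈ T := by
  have hφψ := hC.or (hT.1.1 h)
  by_contra! hn
  refine hT.not_der_cons h (.lOr ?_ ?_)
  · by_contra h'
    exact hn.1 (hT.mem_of_not_der hφψ.1 h')
  · by_contra h'
    exact hn.2 (hT.mem_of_not_der hφψ.2 h')

theorem mem_imp (hC : SubClosed C) (hT : Saturated C Δ T) (h : Form.imp φ ψ ∈ T)
    (hφ : G3Der T.val (some φ)) : ψ ∈ T := by
  refine hT.mem_of_not_der (hC.imp (hT.1.1 h)).2 fun hψ => hT.not_der_cons h (.lImp ?_ hψ)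
  exact hφ.of_subset (Multiset.subset_cons _ _)

end Saturated

/-- The canonical model on the saturated subsets of `C`. -/
def canonicalModel (C : Finset Form) : SLModel {T : Finset Form // ∃ Δ, Saturated C Δ T} where
  le S T := S.1 ⊆ T.1
  rel S T := S.1 ⊂ T.1 ∧ ∀ φ, Form.box φ ∈ S.1 → φ ∈ T.1
  val p T := Form.atom p ∈ T.1
  le_refl _ := Finset.Subset.refl _
  le_trans := Finset.Subset.trans
  le_of_rel h := h.1.1
  rel_of_le_of_rel h h' := ⟨h.trans_ssubset h'.1, fun φ hφ => h'.2 φ (h hφ)⟩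
  wf := by
    refine Subrelation.wf ?_ (measure fun T : {T : Finset Form // ∃ Δ, Saturated C Δ T} =>
      (C \ T.1).card).wf
    intro T S h
    obtain ⟨Δ, hT⟩ := T.2
    obtain ⟨χ, hχT, hχS⟩ := Finset.exists_of_ssubset h.1
    refine Finset.card_lt_card (Finset.ssubset_iff_of_subset
      (Finset.sdiff_subset_sdiff le_rfl h.1.1) |>.2 ⟨χ, ?_, ?_⟩)
    · simp [hT.1.1 hχT, hχS]
    · simp [hχT]
  val_mono h h' := h h'

theorem canonicalModel_truth {C : Finset Form} (hC : SubClosed C) {φ : Form} (hφ : φ ∈ C)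
    (T : {T : Finset Form // ∃ Δ, Saturated C Δ T}) :
    (φ ∈ T.1 → (canonicalModel C).Forces φ T) ∧
      ((canonicalModel C).Forces φ T → G3Der T.1.val (some φ)) := by
  induction φ generalizing T with
  | atom p => exact ⟨fun h => h, fun h => .atom_of_mem h⟩
  | bot =>
    obtain ⟨T, Δ, hT⟩ := T
    exact ⟨fun h => hT.1.2 (.of_bot_mem h), False.elim⟩
  | and φ ψ ih₁ ih₂ =>
    obtain ⟨Δ, hT⟩ := T.2
    have ih₁ := ih₁ (hC.and hφ).1 T
    have ih₂ := ih₂ (hC.and hφ).2 T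
    refine ⟨fun h => ?_, fun h => .rAnd (ih₁.2 h.1) (ih₂.2 h.2)⟩
    have h := hT.mem_and hC h
    exact ⟨ih₁.1 h.1, ih₂.1 h.2⟩
  | or φ ψ ih₁ ih₂ =>
    obtain ⟨Δ, hT⟩ := T.2
    have ih₁ := ih₁ (hC.or hφ).1 T
    have ih₂ := ih₂ (hC.or hφ).2 T
    refine ⟨fun h => (hT.mem_or hC h).imp ih₁.1 ih₂.1, fun h => ?_⟩
    rcases h with h | h
    · exact .rOrL (ih₁.2 h)
    · exact .rOrR (ih₂.2 h)
  | imp φ ψ ih₁ ih₂ =>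
    have hφψ := hC.imp hφ
    obtain ⟨Δ, hT⟩ := T.2
    refine ⟨fun h S hS hS' => ?_, fun h => ?_⟩
    · obtain ⟨Δ', hS₁⟩ := S.2
      exact (ih₂ hφψ.2 S).1 (hS₁.mem_imp hC (hS h) ((ih₁ hφψ.1 S).2 hS'))
    · by_contra hn
      obtain ⟨S, hS, hS'⟩ := Saturated.exists_of_not_der (C := C) (T := insert φ T.1)
        (Δ := some ψ) (Finset.insert_subset hφψ.1 hT.1.1) fun h' =>
          hn (.rImp (h'.of_subset fun χ hχ => by simpa using hχ))
      rw [Finset.insert_subset_iff] at hS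
      exact hS'.1.2 ((ih₂ hφψ.2 ⟨S, _, hS'⟩).2 (h ⟨S, _, hS'⟩ hS.2 ((ih₁ hφψ.1 _).1 hS.1)))
  | box φ ih =>
    have hφ' := hC.box hφ
    obtain ⟨Δ, hT⟩ := T.2
    refine ⟨fun h S hS => (ih hφ' S).1 (hS.2 φ h), fun h => ?_⟩
    by_contra hn
    obtain ⟨P, G, hP, hPG⟩ := exists_noBox_add_boxM T.1.val
    have hmem : ∀ χ, χ ∈ T.1 ↔ χ ∈ P ∨ χ ∈ boxM G := fun χ => by
      rw [← Finset.mem_val, hPG, Multiset.mem_add]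
    have hbox : ∀ χ, Form.box χ ∈ T.1 ↔ χ ∈ G := fun χ => by
      rw [hmem]
      simp only [boxM, Multiset.mem_map, Form.box.injEq, exists_eq_right, or_iff_right_iff_imp]
      exact fun h => absurd rfl (hP _ h χ)
    have hder : ¬ G3Der (Form.box φ ::ₘ (P + boxdot G)) (some φ) := fun h' =>
      hn (hPG ▸ .rSL hP h')
    obtain ⟨S, hS, hS'⟩ := Saturated.exists_of_not_der (C := C)
      (T := (Form.box φ ::ₘ (P + boxdot G)).toFinset) (Δ := some φ) (by
        intro χ hχ
        simp only [boxdot, Multiset.mem_toFinset, Multiset.mem_cons, Multiset.mem_add] at hχ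
        rcases hχ with rfl | hχ | hχ | hχ
        · exact hφ
        · exact hT.1.1 ((hmem χ).2 (.inl hχ))
        · exact hC.box (hT.1.1 ((hbox χ).2 hχ))
        · exact hT.1.1 ((hmem χ).2 (.inr hχ)))
      fun h' => hder (h'.of_subset fun χ hχ => by simpa using hχ)
    have hS₀ : ∀ χ ∈ Form.box φ ::ₘ (P + boxdot G), χ ∈ S := fun χ hχ =>
      hS (Multiset.mem_toFinset.2 hχ)
    refine hS'.1.2 ((ih hφ' ⟨S, _, hS'⟩).2 (h ⟨S, _, hS'⟩ ⟨⟨fun χ hχ => hS₀ χ ?_, ?_⟩, ?_⟩))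
    · rw [hmem] at hχ
      simp only [boxdot, Multiset.mem_cons, Multiset.mem_add]
      tauto
    · exact fun hST => hn (.of_mem (hST (hS₀ (.box φ) (by simp))))
    · exact fun χ hχ => hS₀ χ (by simp [boxdot, (hbox χ).1 hχ])

theorem G3Der.of_forall_model {Γ : Multiset Form} {Δ : Option Form}
    (h : ∀ (W : Type) (M : SLModel W) (w : W), (∀ φ ∈ Γ, M.Forces φ w) → M.ForcesSucc Δ w) :
    G3Der Γ Δ := by
  by_contra hn
  obtain ⟨C, hC, hΓC⟩ := SubClosed.exists_subset (Γ + Δ.toFinset.val)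
  have hΔC : ∀ φ ∈ Δ, φ ∈ C := fun φ hφ => hΓC φ (by simp [Option.mem_def.1 hφ])
  obtain ⟨T, hΓT, hT⟩ := Saturated.exists_of_not_der (C := C) (T := Γ.toFinset) (Δ := Δ)
    (fun φ hφ => hΓC φ (Multiset.mem_add.2 (.inl (Multiset.mem_toFinset.1 hφ))))
    fun h' => hn (h'.of_subset fun χ hχ => by simpa using hχ)
  obtain ⟨φ, hφ, hf⟩ := h _ (canonicalModel C) ⟨T, Δ, hT⟩ fun φ hφ => by
    have hφT : φ ∈ T := hΓT (Multiset.mem_toFinset.2 hφ)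
    exact (canonicalModel_truth hC (hT.1.1 hφT) _).1 hφT
  have hd := (canonicalModel_truth hC (hΔC φ hφ) _).2 hf
  rw [← Option.mem_def.1 hφ] at hd
  exact hT.1.2 hd

theorem G3iSLC.toG3Der {Γ : Multiset Form} {Δ : Option Form} (h : G3iSLC Γ Δ) : G3Der Γ Δ :=
  .of_forall_model fun _ M w hw => h.sound M w hw

/-- cut-elimination for G3iSL□: the cut rule is admissible, i.e.
every sequent derivable in G3iSL□ extended with cut is derivable in G3iSL□. -/
theorem g3isl_cut_elimination :
    (∀ (Γ₁ Γ₂ : Multiset Form) (φ : Form) (Δ : Option Form),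
      G3Der Γ₁ (some φ) → G3Der (φ ::ₘ Γ₂) Δ → G3Der (Γ₁ + Γ₂) Δ) ∧
    (∀ (Γ : Multiset Form) (Δ : Option Form), G3iSLC Γ Δ → G3Der Γ Δ) := by
  refine ⟨fun Γ₁ Γ₂ φ Δ h₁ h₂ => ?_, fun Γ Δ h => h.toG3Der⟩
  obtain ⟨d₁, h₁⟩ := h₁
  obtain ⟨d₂, h₂⟩ := h₂
  exact (G3iSLC.cut h₁.toG3iSLC h₂.toG3iSLC).toG3Der
end

section
/- Every irreducible sequent that is provable in G3iSL□ has a G3iSL□-proof that is both sensible and strict. -/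
/-- Derivation trees for G3iSL□. -/
inductive T3 : Multiset Form → Option Form → Type
  | axAt (Γ : Multiset Form) (p : ℕ) :
      T3 (Form.atom p ::ₘ Γ) (some (Form.atom p))
  | axBot (Γ : Multiset Form) (Δ : Option Form) :
      T3 (Form.bot ::ₘ Γ) Δ
  | rAnd {Γ : Multiset Form} {φ ψ : Form} :
      T3 Γ (some φ) → T3 Γ (some ψ) → T3 Γ (some (Form.and φ ψ))
  | lAnd {Γ : Multiset Form} {φ ψ : Form} {Δ : Option Form} :
      T3 (φ ::ₘ ψ ::ₘ Γ) Δ → T3 (Form.and φ ψ ::ₘ Γ) Δ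
  | rOrL {Γ : Multiset Form} {φ ψ : Form} :
      T3 Γ (some φ) → T3 Γ (some (Form.or φ ψ))
  | rOrR {Γ : Multiset Form} {φ ψ : Form} :
      T3 Γ (some ψ) → T3 Γ (some (Form.or φ ψ))
  | lOr {Γ : Multiset Form} {φ ψ : Form} {Δ : Option Form} :
      T3 (φ ::ₘ Γ) Δ → T3 (ψ ::ₘ Γ) Δ → T3 (Form.or φ ψ ::ₘ Γ) Δ
  | rImp {Γ : Multiset Form} {φ ψ : Form} :
      T3 (φ ::ₘ Γ) (some ψ) → T3 Γ (some (Form.imp φ ψ))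
  | lImp {Γ : Multiset Form} {φ ψ : Form} {Δ : Option Form} :
      T3 (Form.imp φ ψ ::ₘ Γ) (some φ) → T3 (ψ ::ₘ Γ) Δ →
      T3 (Form.imp φ ψ ::ₘ Γ) Δ
  | rSL {S P Γ : Multiset Form} {φ : Form} :
      NoBox P →
      T3 (Form.box φ ::ₘ (P + boxdot Γ)) (some φ) →
      T3 (boxM S + P + boxM Γ) (some (Form.box φ))

/-- The last inference of the derivation is an axiom or an R_SL-inference. -/
def EndsAxOrRSL : ∀ {Γ : Multiset Form} {Δ : Option Form}, T3 Γ Δ → Prop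
  | _, _, T3.axAt _ _ => True
  | _, _, T3.axBot _ _ => True
  | _, _, T3.rSL _ _ => True
  | _, _, _ => False

/-- A proof is sensible if its last inference does not have a principal
formula on the left of the form p→ψ with p an atom. -/
def Sensible : ∀ {Γ : Multiset Form} {Δ : Option Form}, T3 Γ Δ → Prop
  | _, _, @T3.lImp _ φ _ _ _ _ => ∀ p : ℕ, φ ≠ Form.atom p
  | _, _, _ => True

/-- A proof is strict if, in case its last inference is an instance of L→ with
principal formula of the form □φ→ψ, the left premise is an axiom or the
conclusion of an application of R_SL. -/
def Strict : ∀ {Γ : Multiset Form} {Δ : Option Form}, T3 Γ Δ → Prop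
  | _, _, @T3.lImp _ φ _ _ D₁ _ => (∃ φ' : Form, φ = Form.box φ') → EndsAxOrRSL D₁
  | _, _, _ => True

/-- An irreducible multiset: no element is a conjunction, a disjunction or ⊥,
and for no atom p does it contain both p→ψ and p. -/
def IrreducibleMS (Γ : Multiset Form) : Prop :=
  (∀ φ ∈ Γ, (∀ a b : Form, φ ≠ Form.and a b) ∧ (∀ a b : Form, φ ≠ Form.or a b) ∧
      φ ≠ Form.bot) ∧
  ∀ (p : ℕ) (ψ : Form),
    ¬ (Form.atom p ∈ Γ ∧ Form.imp (Form.atom p) ψ ∈ Γ)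

theorem T3.nonempty_of_eq {Γ Γ' : Multiset Form} {Δ : Option Form} (h : Γ = Γ')
    (D : Nonempty (T3 Γ Δ)) : Nonempty (T3 Γ' Δ) := h ▸ D

theorem T3.nonempty_rSL {Θ S P Γ : Multiset Form} {φ : Form} (hP : NoBox P)
    (hΘ : boxM S + P + boxM Γ = Θ)
    (D : Nonempty (T3 (Form.box φ ::ₘ (P + boxdot Γ)) (some φ))) :
    Nonempty (T3 Θ (some (Form.box φ))) := by
  subst hΘ
  exact D.map (T3.rSL hP)

theorem boxM_cons (φ : Form) (Γ : Multiset Form) :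
    boxM (φ ::ₘ Γ) = Form.box φ ::ₘ boxM Γ := Multiset.map_cons _ _ _

theorem noBox_cons {φ : Form} {P : Multiset Form} (hφ : ∀ ψ, φ ≠ Form.box ψ) (hP : NoBox P) :
    NoBox (φ ::ₘ P) := by
  intro χ hχ
  rcases Multiset.mem_cons.1 hχ with rfl | hχ
  exacts [hφ, hP χ hχ]

/-- Weakening on the left is admissible. -/
theorem T3.weaken {Γ : Multiset Form} {Δ : Option Form} (D : T3 Γ Δ) :
    ∀ A : Form, Nonempty (T3 (A ::ₘ Γ) Δ) := by
  induction D with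
  | axAt Γ p => exact fun A => nonempty_of_eq (Multiset.cons_swap _ _ _) ⟨.axAt (A ::ₘ Γ) p⟩
  | axBot Γ Δ => exact fun A => nonempty_of_eq (Multiset.cons_swap _ _ _) ⟨.axBot (A ::ₘ Γ) Δ⟩
  | rAnd _ _ ih₁ ih₂ =>
    intro A
    obtain ⟨E₁⟩ := ih₁ A
    obtain ⟨E₂⟩ := ih₂ A
    exact ⟨.rAnd E₁ E₂⟩
  | @lAnd Γ φ ψ _ _ ih =>
    intro A
    obtain ⟨E⟩ := nonempty_of_eq (Γ' := φ ::ₘ ψ ::ₘ A ::ₘ Γ)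
      (by rw [Multiset.cons_swap A φ, Multiset.cons_swap A ψ]) (ih A)
    exact nonempty_of_eq (Multiset.cons_swap _ _ _) ⟨.lAnd E⟩
  | rOrL _ ih => exact fun A => (ih A).map .rOrL
  | rOrR _ ih => exact fun A => (ih A).map .rOrR
  | lOr _ _ ih₁ ih₂ =>
    intro A
    obtain ⟨E₁⟩ := nonempty_of_eq (Multiset.cons_swap _ _ _) (ih₁ A)
    obtain ⟨E₂⟩ := nonempty_of_eq (Multiset.cons_swap _ _ _) (ih₂ A)
    exact nonempty_of_eq (Multiset.cons_swap _ _ _) ⟨.lOr E₁ E₂⟩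
  | rImp _ ih =>
    intro A
    obtain ⟨E⟩ := nonempty_of_eq (Multiset.cons_swap _ _ _) (ih A)
    exact ⟨.rImp E⟩
  | lImp _ _ ih₁ ih₂ =>
    intro A
    obtain ⟨E₁⟩ := nonempty_of_eq (Multiset.cons_swap _ _ _) (ih₁ A)
    obtain ⟨E₂⟩ := nonempty_of_eq (Multiset.cons_swap _ _ _) (ih₂ A)
    exact nonempty_of_eq (Multiset.cons_swap _ _ _) ⟨.lImp E₁ E₂⟩
  | @rSL S P Γ φ hP D ih =>
    intro A
    by_cases hA : ∃ ψ, A = Form.box ψ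
    · obtain ⟨ψ, rfl⟩ := hA
      exact nonempty_rSL (S := ψ ::ₘ S) hP (by simp [boxM_cons]) ⟨D⟩
    · exact nonempty_rSL (S := S) (P := A ::ₘ P) (Γ := Γ) (noBox_cons (not_exists.1 hA) hP)
        (by simp) (nonempty_of_eq (by rw [Multiset.cons_swap, Multiset.cons_add]) (ih A))

/-- Left implication is invertible with respect to its right premise. -/
theorem T3.inv_lImp {Γ : Multiset Form} {Δ : Option Form} (D : T3 Γ Δ) {φ ψ : Form} :
    ∀ Γ' : Multiset Form, Γ = Form.imp φ ψ ::ₘ Γ' → Nonempty (T3 (ψ ::ₘ Γ') Δ) := by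
  induction D with
  | axAt Γ p =>
    intro Γ' h
    obtain ⟨h, -⟩ | ⟨-, Λ, -, rfl⟩ := Multiset.cons_eq_cons.1 h
    · cases h
    · exact nonempty_of_eq (Multiset.cons_swap _ _ _) ⟨.axAt (ψ ::ₘ Λ) p⟩
  | axBot Γ Δ =>
    intro Γ' h
    obtain ⟨h, -⟩ | ⟨-, Λ, -, rfl⟩ := Multiset.cons_eq_cons.1 h
    · cases h
    · exact nonempty_of_eq (Multiset.cons_swap _ _ _) ⟨.axBot (ψ ::ₘ Λ) Δ⟩
  | rAnd _ _ ih₁ ih₂ =>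
    intro Γ' h
    obtain ⟨E₁⟩ := ih₁ Γ' h
    obtain ⟨E₂⟩ := ih₂ Γ' h
    exact ⟨.rAnd E₁ E₂⟩
  | @lAnd Γ α β _ _ ih =>
    intro Γ' h
    obtain ⟨h, -⟩ | ⟨-, Λ, rfl, rfl⟩ := Multiset.cons_eq_cons.1 h
    · cases h
    · obtain ⟨E⟩ := nonempty_of_eq (Γ' := α ::ₘ β ::ₘ ψ ::ₘ Λ)
        (by rw [Multiset.cons_swap ψ α, Multiset.cons_swap ψ β])
        (ih (α ::ₘ β ::ₘ Λ) (by
          rw [Multiset.cons_swap β, Multiset.cons_swap α]))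
      exact nonempty_of_eq (Multiset.cons_swap _ _ _) ⟨.lAnd E⟩
  | rOrL _ ih => exact fun Γ' h => (ih Γ' h).map .rOrL
  | rOrR _ ih => exact fun Γ' h => (ih Γ' h).map .rOrR
  | @lOr Γ α β _ _ _ ih₁ ih₂ =>
    intro Γ' h
    obtain ⟨h, -⟩ | ⟨-, Λ, rfl, rfl⟩ := Multiset.cons_eq_cons.1 h
    · cases h
    · obtain ⟨E₁⟩ := nonempty_of_eq (Multiset.cons_swap _ _ _)
        (ih₁ (α ::ₘ Λ) (Multiset.cons_swap _ _ _))
      obtain ⟨E₂⟩ := nonempty_of_eq (Multiset.cons_swap _ _ _)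
        (ih₂ (β ::ₘ Λ) (Multiset.cons_swap _ _ _))
      exact nonempty_of_eq (Multiset.cons_swap _ _ _) ⟨.lOr E₁ E₂⟩
  | @rImp Γ α β _ ih =>
    intro Γ' h
    obtain ⟨E⟩ := nonempty_of_eq (Multiset.cons_swap _ _ _)
      (ih (α ::ₘ Γ') (by rw [h, Multiset.cons_swap]))
    exact ⟨.rImp E⟩
  | @lImp Γ α β _ _ D₂ ih₁ ih₂ =>
    intro Γ' h
    obtain ⟨e, rfl⟩ | ⟨-, Λ, rfl, rfl⟩ := Multiset.cons_eq_cons.1 h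
    · cases e
      exact ⟨D₂⟩
    · obtain ⟨E₁⟩ := nonempty_of_eq (Multiset.cons_swap _ _ _) (ih₁ _ h)
      obtain ⟨E₂⟩ := nonempty_of_eq (Multiset.cons_swap _ _ _)
        (ih₂ (β ::ₘ Λ) (Multiset.cons_swap _ _ _))
      exact nonempty_of_eq (Multiset.cons_swap _ _ _) ⟨.lImp E₁ E₂⟩
  | @rSL S P Γ χ hP D ih =>
    intro Γ' h
    have hmem : Form.imp φ ψ ∈ P := by
      have : Form.imp φ ψ ∈ boxM S + P + boxM Γ := h ▸ Multiset.mem_cons_self _ _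
      simpa [boxM] using this
    obtain ⟨Q, rfl⟩ := Multiset.exists_cons_of_mem hmem
    have hQ : NoBox Q := fun α hα => hP α (Multiset.mem_cons_of_mem hα)
    obtain rfl : boxM S + Q + boxM Γ = Γ' := by
      simpa using h
    have E := ih (Form.box χ ::ₘ (Q + boxdot Γ))
      (by rw [Multiset.cons_add, Multiset.cons_swap])
    by_cases hψ : ∃ θ, ψ = Form.box θ
    · obtain ⟨θ, rfl⟩ := hψ
      obtain ⟨E⟩ := E
      refine nonempty_rSL (S := S) (Γ := θ ::ₘ Γ) hQ (by simp [boxM_cons])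
        (nonempty_of_eq ?_ (E.weaken θ))
      rw [boxdot, boxdot, boxM_cons]
      simp only [← Multiset.singleton_add]
      abel
    · exact nonempty_rSL (S := S) (P := ψ ::ₘ Q) (Γ := Γ) (noBox_cons (not_exists.1 hψ) hQ)
        (by simp) (nonempty_of_eq (by rw [Multiset.cons_swap, Multiset.cons_add]) E)

/-- An application of left implication whose principal formula is admissible in a sensible
strict proof. -/
theorem T3.exists_sensible_strict_lImp {Γ Γ' : Multiset Form} {Δ : Option Form} {φ ψ : Form}
    (h : Γ = Form.imp φ ψ ::ₘ Γ') (hat : ∀ p, φ ≠ Form.atom p)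
    (D₁ : ∃ D₁ : T3 Γ (some φ), (∃ φ', φ = Form.box φ') → EndsAxOrRSL D₁)
    (D₂ : Nonempty (T3 (ψ ::ₘ Γ') Δ)) :
    ∃ D : T3 Γ Δ, Sensible D ∧ Strict D := by
  subst h
  obtain ⟨D₁, hD₁⟩ := D₁
  obtain ⟨D₂⟩ := D₂
  exact ⟨.lImp D₁ D₂, hat, hD₁⟩

/-- A sensible strict proof of an irreducible sequent whose succedent is a boxed formula or an
atom not in the antecedent ends with an axiom, with the modal rule, or with a left implication. -/
theorem T3.endsAxOrRSL_or_lImp {Γ : Multiset Form} {Δ : Option Form} {φ : Form} (D : T3 Γ Δ)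
    (hΔ : Δ = some φ) (hirr : IrreducibleMS Γ) (hs : Sensible D) (ht : Strict D)
    (hφ : (∃ p, φ = Form.atom p) ∨ ∃ φ', φ = Form.box φ') :
    EndsAxOrRSL D ∨ ∃ χ θ Γ', Γ = Form.imp χ θ ::ₘ Γ' ∧ (∀ p, χ ≠ Form.atom p) ∧
      (∃ D₁ : T3 Γ (some χ), (∃ χ', χ = Form.box χ') → EndsAxOrRSL D₁) ∧
      Nonempty (T3 (θ ::ₘ Γ') Δ) := by
  cases D with
  | axAt | axBot | rSL => exact .inl trivial
  | rAnd | rOrL | rOrR | rImp => cases hΔ; simp at hφ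
  | lAnd => exact absurd rfl ((hirr.1 _ (Multiset.mem_cons_self _ _)).1 _ _)
  | lOr => exact absurd rfl ((hirr.1 _ (Multiset.mem_cons_self _ _)).2.1 _ _)
  | lImp D₁ D₂ => exact .inr ⟨_, _, _, rfl, hs, ⟨D₁, ht⟩, ⟨D₂⟩⟩

theorem T3.not_endsAxOrRSL_atom {Γ : Multiset Form} {Δ : Option Form} {p : ℕ} (D : T3 Γ Δ)
    (hΔ : Δ = some (Form.atom p)) (hirr : IrreducibleMS Γ) (hp : Form.atom p ∉ Γ) :
    ¬ EndsAxOrRSL D := by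
  cases D with
  | axAt => cases hΔ; simp at hp
  | axBot => exact absurd rfl (hirr.1 _ (Multiset.mem_cons_self _ _)).2.2
  | rSL => cases hΔ
  | _ => exact id

/-- every provable irreducible sequent has a sensible strict
G3iSL□-proof. -/
theorem sensible_strict_proof {Γ : Multiset Form} {Δ : Option Form}
    (hirr : IrreducibleMS Γ) (h : Nonempty (T3 Γ Δ)) :
    ∃ D : T3 Γ Δ, Sensible D ∧ Strict D := by
  obtain ⟨D⟩ := h
  induction D with
  | axAt Γ p => exact ⟨.axAt Γ p, trivial, trivial⟩
  | axBot Γ Δ => exact ⟨.axBot Γ Δ, trivial, trivial⟩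
  | rAnd D₁ D₂ => exact ⟨.rAnd D₁ D₂, trivial, trivial⟩
  | lAnd D => exact ⟨.lAnd D, trivial, trivial⟩
  | rOrL D => exact ⟨.rOrL D, trivial, trivial⟩
  | rOrR D => exact ⟨.rOrR D, trivial, trivial⟩
  | lOr D₁ D₂ => exact ⟨.lOr D₁ D₂, trivial, trivial⟩
  | rImp D => exact ⟨.rImp D, trivial, trivial⟩
  | rSL hP D => exact ⟨.rSL hP D, trivial, trivial⟩
  | @lImp Γ φ ψ Δ D₁ D₂ ih₁ _ =>
    by_cases hφ : (∃ p, φ = Form.atom p) ∨ ∃ φ', φ = Form.box φ'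
    · obtain ⟨E, hs, ht⟩ := ih₁ hirr
      rcases E.endsAxOrRSL_or_lImp rfl hirr hs ht hφ with hE | ⟨χ, θ, Γ', hΓ, hχ, F₁, ⟨F₂⟩⟩
      · refine T3.exists_sensible_strict_lImp rfl ?_ ⟨E, fun _ => hE⟩ ⟨D₂⟩
        rintro p rfl
        exact E.not_endsAxOrRSL_atom rfl hirr
          (fun hp => hirr.2 p ψ ⟨hp, Multiset.mem_cons_self _ _⟩) hE
      · refine T3.exists_sensible_strict_lImp hΓ hχ F₁ ?_
        obtain ⟨e, rfl⟩ | ⟨-, Λ, rfl, rfl⟩ := Multiset.cons_eq_cons.1 hΓ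
        · cases e
          exact ⟨D₂⟩
        · obtain ⟨F₂⟩ := T3.nonempty_of_eq (Multiset.cons_swap _ _ _) ⟨F₂⟩
          obtain ⟨G⟩ := D₂.inv_lImp (ψ ::ₘ Λ) (Multiset.cons_swap _ _ _)
          obtain ⟨G⟩ := T3.nonempty_of_eq (Multiset.cons_swap _ _ _) ⟨G⟩
          exact T3.nonempty_of_eq (Multiset.cons_swap _ _ _) ⟨.lImp F₂ G⟩
    · rw [not_or, not_exists, not_exists] at hφ
      exact ⟨.lImp D₁ D₂, hφ.1, fun ⟨φ', h⟩ => absurd h (hφ.2 φ')⟩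
end

section
/- Soundness of G4iSL□ᵃ with respect to iSL-models: if the sequent Γ ⇒ Δ is derivable in G4iSL□ᵃ, then in every iSL-model every world that forces all formulas of Γ forces the formula of Δ (so Γ ⊨ Δ). -/
/-- The sequent calculus G4iSL□ᵃ. -/
inductive G4a : Multiset Form → Option Form → Prop
  | axAt {Γ : Multiset Form} {p : ℕ} :
      G4a (Form.atom p ::ₘ Γ) (some (Form.atom p))
  | axBot {Γ : Multiset Form} {Δ : Option Form} :
      G4a (Form.bot ::ₘ Γ) Δ
  | rAnd {Γ : Multiset Form} {φ ψ : Form} :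
      G4a Γ (some φ) → G4a Γ (some ψ) → G4a Γ (some (Form.and φ ψ))
  | lAnd {Γ : Multiset Form} {φ ψ : Form} {Δ : Option Form} :
      G4a (φ ::ₘ ψ ::ₘ Γ) Δ → G4a (Form.and φ ψ ::ₘ Γ) Δ
  | rOrL {Γ : Multiset Form} {φ ψ : Form} :
      G4a Γ (some φ) → G4a Γ (some (Form.or φ ψ))
  | rOrR {Γ : Multiset Form} {φ ψ : Form} :
      G4a Γ (some ψ) → G4a Γ (some (Form.or φ ψ))
  | lOr {Γ : Multiset Form} {φ ψ : Form} {Δ : Option Form} :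
      G4a (φ ::ₘ Γ) Δ → G4a (ψ ::ₘ Γ) Δ → G4a (Form.or φ ψ ::ₘ Γ) Δ
  | rImp {Γ : Multiset Form} {φ ψ : Form} :
      G4a (φ ::ₘ Γ) (some ψ) → G4a Γ (some (Form.imp φ ψ))
  | lAtImp {Γ : Multiset Form} {p : ℕ} {φ : Form} {Δ : Option Form} :
      G4a (Form.atom p ::ₘ φ ::ₘ Γ) Δ →
      G4a (Form.atom p ::ₘ Form.imp (Form.atom p) φ ::ₘ Γ) Δ
  | lAndImp {Γ : Multiset Form} {φ ψ χ : Form} {Δ : Option Form} :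
      G4a (Form.imp φ (Form.imp ψ χ) ::ₘ Γ) Δ →
      G4a (Form.imp (Form.and φ ψ) χ ::ₘ Γ) Δ
  | lOrImp {Γ : Multiset Form} {φ ψ χ : Form} {Δ : Option Form} :
      G4a (Form.imp φ χ ::ₘ Form.imp ψ χ ::ₘ Γ) Δ →
      G4a (Form.imp (Form.or φ ψ) χ ::ₘ Γ) Δ
  | lImpImpA {Γ : Multiset Form} {φ ψ χ : Form} {Δ : Option Form} :
      G4a (φ ::ₘ Form.imp ψ χ ::ₘ Γ) (some ψ) →
      G4a (χ ::ₘ Γ) Δ →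
      G4a (Form.imp (Form.imp φ ψ) χ ::ₘ Γ) Δ
  | impSL1 {P Γ : Multiset Form} {φ ψ : Form} {Δ : Option Form} :
      NoBox P → Form.box φ ∉ boxM Γ →
      G4a (Form.imp (Form.box φ) ψ ::ₘ Form.box φ ::ₘ (P + boxdot Γ)) (some φ) →
      G4a (ψ ::ₘ (P + boxM Γ)) Δ →
      G4a (Form.imp (Form.box φ) ψ ::ₘ (P + boxM Γ)) Δ
  | impSL2 {P Γ : Multiset Form} {φ ψ : Form} {Δ : Option Form} :
      NoBox P → Form.box φ ∈ boxM Γ →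
      G4a (ψ ::ₘ (P + boxM Γ)) Δ →
      G4a (Form.imp (Form.box φ) ψ ::ₘ (P + boxM Γ)) Δ
  | rSLa {P Γ : Multiset Form} {φ : Form} :
      NoBox P →
      G4a (Form.box φ ::ₘ (P + boxdot Γ)) (some φ) →
      G4a (P + boxM Γ) (some (Form.box φ))

/-- iSL-models: intuitionistic modal Kripke models in which the modal relation
is transitive, conversely well-founded and a subset of the intuitionistic order. -/
structure ISLModel where
  W : Type
  nonempty : Nonempty W
  le : W → W → Prop
  le_refl : ∀ w, le w w
  le_trans : ∀ ⦃a b c⦄, le a b → le b c → le a c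
  le_antisymm : ∀ ⦃a b⦄, le a b → le b a → a = b
  R : W → W → Prop
  le_R : ∀ ⦃w v x⦄, le w v → R v x → R w x
  V : W → ℕ → Prop
  mono : ∀ ⦃w v⦄, le w v → ∀ ⦃p⦄, V w p → V v p
  R_trans : ∀ ⦃a b c⦄, R a b → R b c → R a c
  /-- conversely well-founded: there is no infinite R-path -/
  cwf : ∀ f : ℕ → W, ¬ ∀ n, R (f n) (f (n + 1))
  R_le : ∀ ⦃a b⦄, R a b → le a b

/-- The forcing relation. -/
def Force (M : ISLModel) : M.W → Form → Prop
  | w, .atom p => M.V w p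
  | _, .bot => False
  | w, .and a b => Force M w a ∧ Force M w b
  | w, .or a b => Force M w a ∨ Force M w b
  | w, .imp a b => ∀ v : M.W, M.le w v → Force M v a → Force M v b
  | w, .box a => ∀ x : M.W, M.R w x → Force M x a

/-- A world forces the (at most one) formula of the succedent. -/
def ForceSuc (M : ISLModel) (w : M.W) (Δ : Option Form) : Prop :=
  ∃ ψ, Δ = some ψ ∧ Force M w ψ

/-- Semantic consequence over all iSL-models. -/
def SemConseq (Γ : Multiset Form) (Δ : Option Form) : Prop :=
  ∀ (M : ISLModel) (w : M.W), (∀ φ ∈ Γ, Force M w φ) → ForceSuc M w Δ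

theorem Force.persistent {M : ISLModel} {φ : Form} {w v : M.W} (hwv : M.le w v)
    (h : Force M w φ) : Force M v φ := by
  induction φ with
  | atom p => exact M.mono hwv h
  | bot => exact h
  | and a b iha ihb => exact ⟨iha h.1, ihb h.2⟩
  | or a b iha ihb => exact h.imp iha ihb
  | imp a b => exact fun u hu => h u (M.le_trans hwv hu)
  | box a => exact fun x hx => h x (M.le_R hwv hx)

theorem ISLModel.wellFounded (M : ISLModel) : WellFounded fun a b : M.W => M.R b a :=
  wellFounded_iff_isEmpty_descending_chain.2 ⟨fun f => M.cwf f.1 f.2⟩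

/-- Löb induction: to force `□φ` one may assume `□φ` at each modal successor. -/
theorem Force.box_of_loeb {M : ISLModel} {φ : Form} {w : M.W}
    (h : ∀ x, M.R w x → Force M x (.box φ) → Force M x φ) : Force M w (.box φ) := by
  intro x
  induction x using M.wellFounded.induction with
  | _ x ih => exact fun hx => h x hx fun y hy => ih y hy (M.R_trans hx hy)

theorem forceSuc_some {M : ISLModel} {w : M.W} {φ : Form} :
    ForceSuc M w (some φ) ↔ Force M w φ := by
  simp [ForceSuc]

theorem Force.boxdot_of_R {M : ISLModel} {P Γ : Multiset Form} {w x : M.W} (hx : M.R w x)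
    (h : ∀ χ ∈ P + boxM Γ, Force M w χ) : ∀ χ ∈ P + boxdot Γ, Force M x χ := by
  intro χ hχ
  rw [boxdot, Multiset.mem_add, Multiset.mem_add] at hχ
  rcases hχ with hχ | hχ | hχ
  · exact (h χ (Multiset.mem_add.2 (.inl hχ))).persistent (M.R_le hx)
  · exact h _ (Multiset.mem_add.2 (.inr (Multiset.mem_map_of_mem _ hχ))) x hx
  · exact (h χ (Multiset.mem_add.2 (.inr hχ))).persistent (M.R_le hx)

/-- soundness of G4iSL□ᵃ with respect to iSL-models. -/
theorem g4a_soundness (Γ : Multiset Form) (Δ : Option Form)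
    (h : G4a Γ Δ) : SemConseq Γ Δ := by
  induction h with
  | axAt => exact fun M w hw => forceSuc_some.2 (hw _ (Multiset.mem_cons_self _ _))
  | axBot => exact fun M w hw => (hw _ (Multiset.mem_cons_self _ _)).elim
  | rAnd _ _ ih₁ ih₂ =>
    exact fun M w hw => forceSuc_some.2
      ⟨forceSuc_some.1 (ih₁ M w hw), forceSuc_some.1 (ih₂ M w hw)⟩
  | lAnd _ ih =>
    intro M w hw
    rw [Multiset.forall_mem_cons] at hw
    refine ih M w ?_
    simp only [Multiset.forall_mem_cons]
    exact ⟨hw.1.1, hw.1.2, hw.2⟩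
  | rOrL _ ih => exact fun M w hw => forceSuc_some.2 (.inl (forceSuc_some.1 (ih M w hw)))
  | rOrR _ ih => exact fun M w hw => forceSuc_some.2 (.inr (forceSuc_some.1 (ih M w hw)))
  | lOr _ _ ih₁ ih₂ =>
    intro M w hw
    rw [Multiset.forall_mem_cons] at hw
    rcases hw.1 with h | h
    · exact ih₁ M w (Multiset.forall_mem_cons.2 ⟨h, hw.2⟩)
    · exact ih₂ M w (Multiset.forall_mem_cons.2 ⟨h, hw.2⟩)
  | rImp _ ih =>
    exact fun M w hw => forceSuc_some.2 fun v hv hφ => forceSuc_some.1 <|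
      ih M v (Multiset.forall_mem_cons.2 ⟨hφ, fun χ hχ => (hw χ hχ).persistent hv⟩)
  | lAtImp _ ih =>
    intro M w hw
    refine ih M w ?_
    simp only [Multiset.forall_mem_cons] at hw ⊢
    exact ⟨hw.1, hw.2.1 w (M.le_refl w) hw.1, hw.2.2⟩
  | lAndImp _ ih =>
    intro M w hw
    refine ih M w ?_
    simp only [Multiset.forall_mem_cons] at hw ⊢
    exact ⟨fun v hv hφ u hu hψ => hw.1 u (M.le_trans hv hu) ⟨hφ.persistent hu, hψ⟩, hw.2⟩
  | lOrImp _ ih =>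
    intro M w hw
    refine ih M w ?_
    simp only [Multiset.forall_mem_cons] at hw ⊢
    exact ⟨fun v hv hφ => hw.1 v hv (.inl hφ), fun v hv hψ => hw.1 v hv (.inr hψ), hw.2⟩
  | lImpImpA _ _ ih₁ ih₂ =>
    intro M w hw
    rw [Multiset.forall_mem_cons] at hw
    refine ih₂ M w (Multiset.forall_mem_cons.2 ⟨hw.1 w (M.le_refl w) fun v hv hφ => ?_, hw.2⟩)
    refine forceSuc_some.1 (ih₁ M v ?_)
    simp only [Multiset.forall_mem_cons]
    exact ⟨hφ, fun u hu hψ => hw.1 u (M.le_trans hv hu) fun t ht _ => hψ.persistent ht,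
      fun χ hχ => (hw.2 χ hχ).persistent hv⟩
  | impSL1 _ _ _ _ ih₁ ih₂ =>
    intro M w hw
    rw [Multiset.forall_mem_cons] at hw
    refine ih₂ M w (Multiset.forall_mem_cons.2 ⟨hw.1 w (M.le_refl w) ?_, hw.2⟩)
    refine Force.box_of_loeb fun x hx hφ => forceSuc_some.1 (ih₁ M x ?_)
    simp only [Multiset.forall_mem_cons]
    exact ⟨hw.1.persistent (M.R_le hx), hφ, Force.boxdot_of_R hx hw.2⟩
  | impSL2 _ hmem _ ih =>
    intro M w hw
    rw [Multiset.forall_mem_cons] at hw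
    exact ih M w (Multiset.forall_mem_cons.2
      ⟨hw.1 w (M.le_refl w) (hw.2 _ (Multiset.mem_add.2 (.inr hmem))), hw.2⟩)
  | rSLa _ _ ih =>
    exact fun M w hw => forceSuc_some.2 <| Force.box_of_loeb fun x hx hφ =>
      forceSuc_some.1 (ih M x (Multiset.forall_mem_cons.2 ⟨hφ, Force.boxdot_of_R hx hw⟩))
end

section
/- Semantic invertibility for G4iSL□ᵃ: for each invertible rule of G4iSL□ᵃ (namely R∧, L∧, L∨, R→, Lp→, L∧→, L∨→ and →SL,2), if some world w of an iSL-model refutes one of the premises of the rule (i.e., w forces all formulas of its antecedent but does not force its succedent), then w refutes the conclusion of the rule. -/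
/-- A world refutes a sequent if it forces every formula of the antecedent but
does not force the formula of the succedent (or the succedent is empty). -/
def Refutes (M : ISLModel) (w : M.W) (Γ : Multiset Form) (Δ : Option Form) : Prop :=
  (∀ φ ∈ Γ, Force M w φ) ∧ ¬ ForceSuc M w Δ

theorem Force.mono {M : ISLModel} {w v : M.W} (h : M.le w v) {φ : Form}
    (hφ : Force M w φ) : Force M v φ := by
  induction φ with
  | atom p => exact M.mono h hφ
  | bot => exact hφ
  | and a b iha ihb => exact ⟨iha hφ.1, ihb hφ.2⟩
  | or a b iha ihb => exact hφ.imp iha ihb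
  | imp a b _ _ => exact fun u hu => hφ u (M.le_trans h hu)
  | box a _ => exact fun x hx => hφ x (M.le_R h hx)

theorem refutes_cons {M : ISLModel} {w : M.W} {φ : Form} {Γ : Multiset Form}
    {Δ : Option Form} :
    Refutes M w (φ ::ₘ Γ) Δ ↔ Force M w φ ∧ Refutes M w Γ Δ := by
  simp only [Refutes, Multiset.forall_mem_cons, and_assoc]

/-- semantic invertibility of the invertible rules of G4iSL□ᵃ
(R∧, L∧, L∨, R→, Lp→, L∧→, L∨→ and →SL,2): if a world of an iSL-model refutes
one of the premises of the rule, it refutes the conclusion. -/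
theorem g4a_semantic_invertibility (M : ISLModel) (w : M.W) :
    (∀ (Γ : Multiset Form) (φ ψ : Form),
      (Refutes M w Γ (some φ) ∨ Refutes M w Γ (some ψ)) →
      Refutes M w Γ (some (Form.and φ ψ))) ∧
    (∀ (Γ : Multiset Form) (φ ψ : Form) (Δ : Option Form),
      Refutes M w (φ ::ₘ ψ ::ₘ Γ) Δ → Refutes M w (Form.and φ ψ ::ₘ Γ) Δ) ∧
    (∀ (Γ : Multiset Form) (φ ψ : Form) (Δ : Option Form),
      (Refutes M w (φ ::ₘ Γ) Δ ∨ Refutes M w (ψ ::ₘ Γ) Δ) →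
      Refutes M w (Form.or φ ψ ::ₘ Γ) Δ) ∧
    (∀ (Γ : Multiset Form) (φ ψ : Form),
      Refutes M w (φ ::ₘ Γ) (some ψ) → Refutes M w Γ (some (Form.imp φ ψ))) ∧
    (∀ (Γ : Multiset Form) (p : ℕ) (φ : Form) (Δ : Option Form),
      Refutes M w (Form.atom p ::ₘ φ ::ₘ Γ) Δ →
      Refutes M w (Form.atom p ::ₘ Form.imp (Form.atom p) φ ::ₘ Γ) Δ) ∧
    (∀ (Γ : Multiset Form) (φ ψ γ : Form) (Δ : Option Form),
      Refutes M w (Form.imp φ (Form.imp ψ γ) ::ₘ Γ) Δ →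
      Refutes M w (Form.imp (Form.and φ ψ) γ ::ₘ Γ) Δ) ∧
    (∀ (Γ : Multiset Form) (φ ψ γ : Form) (Δ : Option Form),
      Refutes M w (Form.imp φ γ ::ₘ Form.imp ψ γ ::ₘ Γ) Δ →
      Refutes M w (Form.imp (Form.or φ ψ) γ ::ₘ Γ) Δ) ∧
    (∀ (P Γ : Multiset Form) (φ ψ : Form) (Δ : Option Form),
      NoBox P → Form.box φ ∈ boxM Γ →
      Refutes M w (ψ ::ₘ (P + boxM Γ)) Δ →
      Refutes M w (Form.imp (Form.box φ) ψ ::ₘ (P + boxM Γ)) Δ) := by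
  simp only [refutes_cons]
  refine ⟨?_, ?_, ?_, ?_, ?_, ?_, ?_, ?_⟩
  · intro Γ φ ψ h
    simp only [Refutes, forceSuc_some] at h ⊢
    rcases h with ⟨hΓ, h⟩ | ⟨hΓ, h⟩
    · exact ⟨hΓ, fun hc => h hc.1⟩
    · exact ⟨hΓ, fun hc => h hc.2⟩
  · rintro Γ φ ψ Δ ⟨hφ, hψ, h⟩
    exact ⟨⟨hφ, hψ⟩, h⟩
  · rintro Γ φ ψ Δ (⟨hφ, h⟩ | ⟨hψ, h⟩)
    · exact ⟨Or.inl hφ, h⟩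
    · exact ⟨Or.inr hψ, h⟩
  · rintro Γ φ ψ ⟨hφ, hΓ, h⟩
    rw [forceSuc_some] at h
    exact ⟨hΓ, fun hc => h (forceSuc_some.mp hc w (M.le_refl w) hφ)⟩
  · rintro Γ p φ Δ ⟨hp, hφ, h⟩
    exact ⟨hp, fun v hv _ => hφ.mono hv, h⟩
  · rintro Γ φ ψ γ Δ ⟨himp, h⟩
    exact ⟨fun v hv hφψ => himp v hv hφψ.1 v (M.le_refl v) hφψ.2, h⟩
  · rintro Γ φ ψ γ Δ ⟨hφγ, hψγ, h⟩
    exact ⟨fun v hv hφψ => hφψ.elim (hφγ v hv) (hψγ v hv), h⟩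
  · rintro P Γ φ ψ Δ - - ⟨hψ, h⟩
    exact ⟨fun v hv _ => hψ.mono hv, h⟩
end
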